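/- arXiv:1908.09350 — 2 statements merged into one kernel-verified Lean document; each statement's English description precedes it below -/
import Mathlib

section
/- Let Δ be a d-dimensional orientable pseudomanifold without boundary (∂Δ = ∅), with d-faces oriented as γ_1,…,γ_m so that ∂_d(γ_1 + ⋯ + γ_m) = 0. Let σ = Σ_{k=1}^m s_k ∂_d(γ_k) and τ = Σ_{k=1}^m t_k ∂_d(γ_k) be (d−1)-chains with integer coefficients s_k, t_k. Then σ − τ ∈ im L_{d−1} (i.e., σ and τ are linearly equivalent) if and only if Σ_{k=1}^m s_k ≡ Σ_{k=1}^m t_k (mod m). -/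
open Finset Matrix

/-- A finite abstract simplicial complex on the vertex set `Fin n`: a collection of
finite subsets of `Fin n` (its faces) closed under taking subsets. -/
structure SComplex (n : ℕ) where
  faces : Finset (Finset (Fin n))
  down_closed : ∀ s ∈ faces, ∀ t ⊆ s, t ∈ faces

namespace SComplex

variable {n : ℕ} (Δ : SComplex n)

/-- The faces of cardinality `k`, i.e. the `(k-1)`-dimensional faces. -/
def Faces (k : ℕ) : Finset (Finset (Fin n)) :=
  Δ.faces.filter fun f => f.card = k

/-- The group of `(k-1)`-dimensional chains: formal `ℤ`-linear combinations of the
faces of cardinality `k`.  (So `Chain 0` plays the role of `C_{-1}(Δ) ≅ ℤ`, generated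
by the empty face, and `Chain (i+1)` is the group `C_i(Δ)` of `i`-dimensional chains.) -/
abbrev Chain (k : ℕ) : Type := {f // f ∈ Δ.Faces k} → ℤ

/-- The sign `(-1)^j` with which the subface `g` (obtained from `f` by deleting its
`j`-th smallest vertex) occurs in the boundary of `f`; `0` if `g` is not a
codimension-one subface of `f`. -/
def bcoef (f g : Finset (Fin n)) : ℤ :=
  if g ⊆ f ∧ f.card = g.card + 1 then
    ∑ v ∈ f \ g, (-1 : ℤ) ^ (f.filter (fun x => x < v)).card
  else 0

/-- The matrix (in the standard bases, with the standard orientation) of the boundary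
map from chains on faces of cardinality `k+1` to chains on faces of cardinality `k`. -/
def B (k : ℕ) : Matrix {f // f ∈ Δ.Faces k} {f // f ∈ Δ.Faces (k + 1)} ℤ :=
  fun g f => bcoef (f : Finset (Fin n)) (g : Finset (Fin n))

/-- The simplicial boundary map `∂_k : C_k(Δ) → C_{k-1}(Δ)` (standard orientation),
as a map `Chain (k+1) → Chain k`.  For `k = 0` this is the reduced boundary map into
`C_{-1}(Δ) ≅ ℤ`. -/
noncomputable def bdry (k : ℕ) : Δ.Chain (k + 1) →ₗ[ℤ] Δ.Chain k :=
  (Δ.B k).mulVecLin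

/-- The transpose `∂_kᵗ` of the boundary map. -/
noncomputable def tbdry (k : ℕ) : Δ.Chain k →ₗ[ℤ] Δ.Chain (k + 1) :=
  ((Δ.B k)ᵀ).mulVecLin

/-- The matrix of the `i`-th (up-down combinatorial) Laplacian. -/
def LapM (i : ℕ) : Matrix {f // f ∈ Δ.Faces (i + 1)} {f // f ∈ Δ.Faces (i + 1)} ℤ :=
  Δ.B (i + 1) * (Δ.B (i + 1))ᵀ

/-- The `i`-th Laplacian `L_i = ∂_{i+1} ∘ ∂_{i+1}ᵗ` on `i`-dimensional chains. -/
noncomputable def Lap (i : ℕ) : Δ.Chain (i + 1) →ₗ[ℤ] Δ.Chain (i + 1) :=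
  (Δ.LapM i).mulVecLin

/-- A chain is effective if all of its coefficients are nonnegative. -/
def Effective {k : ℕ} (σ : Δ.Chain k) : Prop := ∀ f, 0 ≤ σ f

/-- `σ·h = Σ_f σ(f)h(f)`. -/
def dot {k : ℕ} (σ h : Δ.Chain k) : ℤ := ∑ f, σ f * h f

/-- The `i`-th nonnegative kernel `ker⁺L_i`: effective `i`-chains in `ker L_i`. -/
def kerPlus (i : ℕ) : Set (Δ.Chain (i + 1)) :=
  {τ | Δ.Lap i τ = 0 ∧ Δ.Effective τ}

/-- Two `i`-chains are linearly equivalent if their difference lies in `im L_i`. -/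
def LinEquiv (i : ℕ) (σ σ' : Δ.Chain (i + 1)) : Prop :=
  σ' - σ ∈ LinearMap.range (Δ.Lap i)

/-- An `i`-chain is winnable if it is linearly equivalent to an effective `i`-chain. -/
def Winnable (i : ℕ) (σ : Δ.Chain (i + 1)) : Prop :=
  ∃ σ', Δ.Effective σ' ∧ Δ.LinEquiv i σ σ'

/-- The Hilbert basis of `ker⁺L_i`: its nonzero elements that are not the sum of two
nonzero elements of `ker⁺L_i`. -/
def hilbBasis (i : ℕ) : Set (Δ.Chain (i + 1)) :=
  {τ | τ ∈ Δ.kerPlus i ∧ τ ≠ 0 ∧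
    ¬ ∃ a ∈ Δ.kerPlus i, ∃ b ∈ Δ.kerPlus i, a ≠ 0 ∧ b ≠ 0 ∧ τ = a + b}

/-- The cycles among the chains on faces of cardinality `k`: the kernel of the
(reduced) boundary map `∂_{k-1}`.  For `k = 0` (the `(-1)`-chains, where the boundary
map is zero) every chain is a cycle. -/
noncomputable def cycles : (k : ℕ) → Submodule ℤ (Δ.Chain k)
  | 0 => ⊤
  | (k + 1) => LinearMap.ker (Δ.bdry k)

/-- The image of the `i`-th Laplacian, viewed inside the `i`-cycles. -/
noncomputable def critSub (i : ℕ) : Submodule ℤ ↥(Δ.cycles (i + 1)) :=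
  Submodule.comap (Δ.cycles (i + 1)).subtype (LinearMap.range (Δ.Lap i))

/-- The `i`-th critical group `crit_i(Δ) = ker ∂_i / im L_i`. -/
noncomputable abbrev Crit (i : ℕ) : Type :=
  ↥(Δ.cycles (i + 1)) ⧸ Δ.critSub i

/-- The image of the boundary map `∂_k`, viewed inside the cycles `cycles k`. -/
noncomputable def bdrySub (k : ℕ) : Submodule ℤ ↥(Δ.cycles k) :=
  Submodule.comap (Δ.cycles k).subtype (LinearMap.range (Δ.bdry k))

/-- The reduced homology group `H̃_{k-1}(Δ) = ker ∂_{k-1} / im ∂_k` (so the `i`-th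
reduced homology group of `Δ` is `RedHomologyAt (i+1)`). -/
noncomputable abbrev RedHomologyAt (k : ℕ) : Type :=
  ↥(Δ.cycles k) ⧸ Δ.bdrySub k

/-- The orthogonal complement `(ker L_i)^⊥` of `ker L_i` in the `i`-chains. -/
def kerPerp (i : ℕ) : Submodule ℤ (Δ.Chain (i + 1)) where
  carrier := {σ | ∀ τ ∈ LinearMap.ker (Δ.Lap i), Δ.dot σ τ = 0}
  add_mem' := by
    intro a b ha hb τ hτ
    have h : Δ.dot (a + b) τ = Δ.dot a τ + Δ.dot b τ := by
      simp [dot, Pi.add_apply, add_mul, Finset.sum_add_distrib]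
    rw [h, ha τ hτ, hb τ hτ, add_zero]
  zero_mem' := by
    intro τ hτ
    simp [dot]
  smul_mem' := by
    intro c a ha τ hτ
    have h : Δ.dot (c • a) τ = c * Δ.dot a τ := by
      simp [dot, Pi.smul_apply, Finset.mul_sum, mul_assoc]
    rw [h, ha τ hτ, mul_zero]

/-! ### Pseudomanifolds -/

/-- `Δ` is a pseudomanifold of dimension `d` (the facets are the faces of
cardinality `d+1`): it is pure, non-branching, and strongly connected. -/
def IsPseudomanifold (d : ℕ) : Prop :=
  (∀ f ∈ Δ.faces, ∃ g ∈ Δ.Faces (d + 1), f ⊆ g) ∧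
  (∀ g ∈ Δ.Faces d, ((Δ.Faces (d + 1)).filter fun f => g ⊆ f).card ≤ 2) ∧
  (∀ f ∈ Δ.Faces (d + 1), ∀ f' ∈ Δ.Faces (d + 1),
    Relation.ReflTransGen
      (fun a b => a ∈ Δ.Faces (d + 1) ∧ b ∈ Δ.Faces (d + 1) ∧ (a ∩ b).card = d) f f')

/-- The boundary `∂Δ` of a `d`-dimensional pseudomanifold: the `(d-1)`-faces contained
in exactly one facet. -/
def pmBoundary (d : ℕ) : Finset (Finset (Fin n)) :=
  (Δ.Faces d).filter fun g => ((Δ.Faces (d + 1)).filter fun f => g ⊆ f).card = 1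

/-- A pseudomanifold orientation for a `d`-dimensional pseudomanifold: a top chain
`γ` with all coefficients `±1` whose boundary is supported on `∂Δ`. -/
noncomputable def IsOrientation (d : ℕ) (γ : Δ.Chain (d + 1)) : Prop :=
  (∀ f, γ f = 1 ∨ γ f = -1) ∧
  (∀ g : {f // f ∈ Δ.Faces d},
    (g : Finset (Fin n)) ∉ Δ.pmBoundary d → Δ.bdry d γ g = 0)

/-- `γ_j` as a top-dimensional chain, for a vertex `j` of the `γ`-incidence graph:
the extra vertex `γ_0 = 0` is encoded by `none`, and the oriented facet `γ_f` by
`some f`. -/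
noncomputable def gammaInd (D : ℕ) (γ : Δ.Chain (D + 1)) :
    Option {f // f ∈ Δ.Faces (D + 1)} → Δ.Chain (D + 1)
  | none => 0
  | some f => Pi.single f (γ f)

/-- The edge of the `γ`-incidence graph corresponding to the `(D-1)`-dimensional face
`σ` goes from the vertex `a` to the vertex `b`: this means `∂ᵗ(σ) = γ_b - γ_a`. -/
noncomputable def edgeFromTo (D : ℕ) (γ : Δ.Chain (D + 1)) (σ : {f // f ∈ Δ.Faces D})
    (a b : Option {f // f ∈ Δ.Faces (D + 1)}) : Prop :=
  Δ.tbdry D (Pi.single σ 1) = Δ.gammaInd D γ b - Δ.gammaInd D γ a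

/-- `τ` is the incidence vector of a simple directed cycle of the `γ`-incidence graph
`Γ(Δ,γ)`: there is a closed directed walk with pairwise distinct vertices and pairwise
distinct edges whose edge labels sum to `τ`. -/
noncomputable def IsCycleVector (D : ℕ) (γ : Δ.Chain (D + 1)) (τ : Δ.Chain D) : Prop :=
  ∃ (k : ℕ) (hk : 0 < k) (v : Fin k → Option {f // f ∈ Δ.Faces (D + 1)})
    (e : Fin k → {f // f ∈ Δ.Faces D}),
    Function.Injective v ∧ Function.Injective e ∧
    (∀ t : Fin k, Δ.edgeFromTo D γ (e t) (v t) (v ⟨(t.1 + 1) % k, Nat.mod_lt _ hk⟩)) ∧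
    τ = ∑ t : Fin k, Pi.single (e t) (1 : ℤ)

/-! ### Spanning forests -/

/-- The chains supported on a set `F` of faces. -/
def suppIn (k : ℕ) (F : Finset (Finset (Fin n))) : Submodule ℤ (Δ.Chain k) where
  carrier := {σ | ∀ f : {f // f ∈ Δ.Faces k}, (f : Finset (Fin n)) ∉ F → σ f = 0}
  add_mem' := by
    intro a b ha hb f hf
    simp [Pi.add_apply, ha f hf, hb f hf]
  zero_mem' := by intro f hf; rfl
  smul_mem' := by
    intro c a ha f hf
    simp [Pi.smul_apply, ha f hf]

/-- The reduced homology group `H̃_{i-1}(Υ)` of the subcomplex `Υ` with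
`Skel_{i-1}(Υ) = Skel_{i-1}(Δ)` and with set of `i`-faces `F`: namely
`ker ∂_{i-1} / ∂_i(chains supported on F)`. -/
noncomputable abbrev forestHom (i : ℕ) (F : Finset (Finset (Fin n))) : Type :=
  ↥(Δ.cycles i) ⧸ Submodule.comap (Δ.cycles i).subtype
      (Submodule.map (Δ.bdry i) (Δ.suppIn (i + 1) F))

/-- `F ⊆ Δ_i` encodes a spanning `i`-forest of `Δ`: the `i`-dimensional subcomplex
`Υ` with `Skel_{i-1}(Υ) = Skel_{i-1}(Δ)` and with `i`-faces `F`, subject to: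
`H̃_i(Υ) = 0`; `β̃_{i-1}(Υ) = β̃_{i-1}(Δ)`; and `|Υ_i| = |Δ_i| - β̃_i(Skel_i(Δ))`
(note `H̃_i(Skel_i(Δ)) = ker ∂_i` since `Skel_i(Δ)` has no `(i+1)`-faces). -/
noncomputable def IsSpanningForest (i : ℕ) (F : Finset (Finset (Fin n))) : Prop :=
  F ⊆ Δ.Faces (i + 1) ∧
  (∀ σ ∈ Δ.suppIn (i + 1) F, Δ.bdry i σ = 0 → σ = 0) ∧
  Module.finrank ℤ (Δ.forestHom i F) = Module.finrank ℤ (Δ.RedHomologyAt i) ∧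
  F.card = (Δ.Faces (i + 1)).card - Module.finrank ℤ ↥(Δ.cycles (i + 1))

open scoped Classical in
/-- The `i`-forest number `τ_i(Δ) = Σ_Υ |T(H̃_{i-1}(Υ))|²`, the sum over all spanning
`i`-forests of `Δ`. -/
noncomputable def forestNumber (i : ℕ) : ℕ :=
  ∑ F ∈ (Δ.Faces (i + 1)).powerset.filter (fun F => Δ.IsSpanningForest i F),
    (Nat.card ↥(Submodule.torsion ℤ (Δ.forestHom i F))) ^ 2

/-- Restriction of chains to the coordinates indexed by a subset `Θ` of the faces
(i.e. setting the remaining coordinates to `0`). -/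
noncomputable def restrictTo (k : ℕ) (Θ : Finset (Finset (Fin n)))
    (hΘ : Θ ⊆ Δ.Faces k) : Δ.Chain k →ₗ[ℤ] ({f // f ∈ Θ} → ℤ) where
  toFun σ := fun a => σ ⟨a.1, hΘ a.2⟩
  map_add' := by intros; rfl
  map_smul' := by intros; rfl

/-- The reduced Laplacian: the square submatrix of `L_i` consisting of the rows
and columns indexed by `Θ`, as a linear map `ℤΘ → ℤΘ`. -/
noncomputable def redLap (i : ℕ) (Θ : Finset (Finset (Fin n)))
    (hΘ : Θ ⊆ Δ.Faces (i + 1)) : ({f // f ∈ Θ} → ℤ) →ₗ[ℤ] ({f // f ∈ Θ} → ℤ) :=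
  (Matrix.of fun a b : {f // f ∈ Θ} =>
    Δ.LapM i ⟨a.1, hΘ a.2⟩ ⟨b.1, hΘ b.2⟩).mulVecLin

end SComplex

namespace SComplex

variable {n : ℕ} {Δ : SComplex n}

theorem bcoef_eq_one_or_neg_one {f g : Finset (Fin n)} (h : g ⊆ f) (hc : f.card = g.card + 1) :
    bcoef f g = 1 ∨ bcoef f g = -1 := by
  have h1 : (f \ g).card = 1 := by
    rw [card_sdiff_of_subset h]
    omega
  obtain ⟨v, hv⟩ := card_eq_one.mp h1
  rw [bcoef, if_pos ⟨h, hc⟩, hv, sum_singleton]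
  exact neg_one_pow_eq_or ℤ _

theorem bcoef_eq_zero_of_not_subset {f g : Finset (Fin n)} (h : ¬ g ⊆ f) : bcoef f g = 0 :=
  if_neg fun h' => h h'.1

theorem dotProduct_tbdry {k : ℕ} (x : Δ.Chain (k + 1)) (c : Δ.Chain k) :
    x ⬝ᵥ Δ.tbdry k c = Δ.bdry k x ⬝ᵥ c := by
  simp only [tbdry, bdry, mulVecLin_apply, dotProduct_mulVec, vecMul_transpose]

theorem Lap_apply (i : ℕ) (c : Δ.Chain (i + 1)) :
    Δ.Lap i c = Δ.bdry (i + 1) (Δ.tbdry (i + 1) c) := by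
  simp [Lap, LapM, bdry, tbdry]

/-- The row of the boundary matrix at a face shared by two facets of a non-branching complex. -/
theorem tbdry_single_eq {k : ℕ} {g : {f // f ∈ Δ.Faces k}} {a b : {f // f ∈ Δ.Faces (k + 1)}}
    (hg : ((Δ.Faces (k + 1)).filter fun f => (g : Finset (Fin n)) ⊆ f).card ≤ 2)
    (hab : a ≠ b) (hga : (g : Finset (Fin n)) ⊆ a) (hgb : (g : Finset (Fin n)) ⊆ b) :
    Δ.tbdry k (Pi.single g 1) = Pi.single a (Δ.B k g a) + Pi.single b (Δ.B k g b) := by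
  have hpair : ({(a : Finset (Fin n)), (b : Finset (Fin n))} : Finset (Finset (Fin n))) =
      (Δ.Faces (k + 1)).filter fun f => (g : Finset (Fin n)) ⊆ f := by
    refine eq_of_subset_of_card_le ?_ ?_
    · intro f hf
      rcases mem_insert.mp hf with rfl | hf
      · exact mem_filter.mpr ⟨a.2, hga⟩
      · rw [mem_singleton.mp hf]
        exact mem_filter.mpr ⟨b.2, hgb⟩
    · rwa [card_pair (fun h => hab (Subtype.ext h))]
  ext f
  have hrow : Δ.tbdry k (Pi.single g 1) f = Δ.B k g f := by simp [tbdry]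
  rw [hrow, Pi.add_apply]
  by_cases hfa : f = a
  · subst hfa
    simp [hab]
  by_cases hfb : f = b
  · subst hfb
    simp [hfa]
  rw [Pi.single_eq_of_ne hfa, Pi.single_eq_of_ne hfb, add_zero]
  refine bcoef_eq_zero_of_not_subset fun hgf => ?_
  have hf := mem_filter.mpr (⟨f.2, hgf⟩ : (f : Finset (Fin n)) ∈ Δ.Faces (k + 1) ∧ _)
  rw [← hpair] at hf
  simp only [mem_insert, mem_singleton, SetLike.coe_eq_coe] at hf
  exact hf.elim hfa hfb

theorem single_sub_single_mem_range_tbdry_of_adj {k : ℕ} (hpm : Δ.IsPseudomanifold k)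
    {γ : Δ.Chain (k + 1)} (hγ0 : Δ.bdry k γ = 0) (a b : {f // f ∈ Δ.Faces (k + 1)})
    (hab : ((a : Finset (Fin n)) ∩ b).card = k) :
    (Pi.single a (γ a) - Pi.single b (γ b) : Δ.Chain (k + 1)) ∈
      LinearMap.range (Δ.tbdry k) := by
  have hac : (a : Finset (Fin n)).card = k + 1 := (mem_filter.mp a.2).2
  have hbc : (b : Finset (Fin n)).card = k + 1 := (mem_filter.mp b.2).2
  have hne : a ≠ b := by
    rintro rfl
    rw [inter_self] at hab
    omega
  let g : {f // f ∈ Δ.Faces k} :=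
    ⟨a ∩ b, mem_filter.mpr
      ⟨Δ.down_closed _ (mem_filter.mp a.2).1 _ inter_subset_left, hab⟩⟩
  have hrow := tbdry_single_eq (g := g) (hpm.2.1 g g.2) hne inter_subset_left inter_subset_right
  have hA : Δ.B k g a = 1 ∨ Δ.B k g a = -1 :=
    bcoef_eq_one_or_neg_one inter_subset_left (by rw [hac, hab])
  have hB : Δ.B k g b = 1 ∨ Δ.B k g b = -1 :=
    bcoef_eq_one_or_neg_one inter_subset_right (by rw [hbc, hab])
  have hcycle : γ a * Δ.B k g a + γ b * Δ.B k g b = 0 := by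
    have h := dotProduct_tbdry γ (Pi.single g 1)
    rwa [hγ0, zero_dotProduct, hrow, dotProduct_add, dotProduct_single, dotProduct_single] at h
  refine ⟨Pi.single g (γ a * Δ.B k g a), ?_⟩
  have hsmul : (Pi.single g (γ a * Δ.B k g a) : Δ.Chain k) =
      (γ a * Δ.B k g a) • Pi.single g 1 := by
    rw [← Pi.single_smul, smul_eq_mul, mul_one]
  have hAA : γ a * Δ.B k g a * Δ.B k g a = γ a := by
    rcases hA with h | h <;> simp [h]
  have hAB : γ a * Δ.B k g a * Δ.B k g b = -γ b := by
    rw [eq_neg_of_add_eq_zero_left hcycle]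
    rcases hB with h | h <;> simp [h]
  rw [hsmul, map_smul, hrow, smul_add, ← Pi.single_smul, ← Pi.single_smul, smul_eq_mul,
    smul_eq_mul, hAA, hAB, Pi.single_neg, sub_eq_add_neg]

theorem single_sub_single_mem_range_tbdry {k : ℕ} (hpm : Δ.IsPseudomanifold k)
    {γ : Δ.Chain (k + 1)} (hγ0 : Δ.bdry k γ = 0) (a b : {f // f ∈ Δ.Faces (k + 1)}) :
    (Pi.single a (γ a) - Pi.single b (γ b) : Δ.Chain (k + 1)) ∈
      LinearMap.range (Δ.tbdry k) := by
  obtain ⟨b, hb⟩ := b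
  have hpath := hpm.2.2 a a.2 b hb
  induction hpath with
  | refl => simp
  | tail _ hstep ih =>
    have h := add_mem (ih hstep.1)
      (single_sub_single_mem_range_tbdry_of_adj hpm hγ0 ⟨_, hstep.1⟩ ⟨_, hb⟩ hstep.2.2)
    rwa [sub_add_sub_cancel] at h

/-- The cycles of top dimension of an oriented pseudomanifold are the multiples of `γ`. -/
theorem exists_eq_smul_of_bdry_eq_zero {k : ℕ} (hpm : Δ.IsPseudomanifold k)
    {γ : Δ.Chain (k + 1)} (hγ : ∀ f, γ f = 1 ∨ γ f = -1) (hγ0 : Δ.bdry k γ = 0)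
    {x : Δ.Chain (k + 1)} (hx : Δ.bdry k x = 0) : ∃ z : ℤ, x = z • γ := by
  rcases isEmpty_or_nonempty {f // f ∈ Δ.Faces (k + 1)} with _ | ⟨⟨a⟩⟩
  · exact ⟨0, Subsingleton.elim _ _⟩
  refine ⟨x a * γ a, funext fun b => ?_⟩
  obtain ⟨c, hc⟩ := single_sub_single_mem_range_tbdry hpm hγ0 a b
  have h := dotProduct_tbdry x c
  rw [hx, zero_dotProduct, hc, dotProduct_sub, dotProduct_single, dotProduct_single,
    sub_eq_zero] at h
  rw [Pi.smul_apply, smul_eq_mul, h]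
  rcases hγ b with hb | hb <;> simp [hb]

/-- The image of the coboundary into top chains of an oriented pseudomanifold is the orthogonal
complement of `γ`. -/
theorem mem_range_tbdry_iff {k : ℕ} (hpm : Δ.IsPseudomanifold k)
    {γ : Δ.Chain (k + 1)} (hγ : ∀ f, γ f = 1 ∨ γ f = -1) (hγ0 : Δ.bdry k γ = 0)
    {x : Δ.Chain (k + 1)} : x ∈ LinearMap.range (Δ.tbdry k) ↔ γ ⬝ᵥ x = 0 := by
  constructor
  · rintro ⟨c, rfl⟩
    rw [dotProduct_tbdry, hγ0, zero_dotProduct]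
  · intro hx
    rcases isEmpty_or_nonempty {f // f ∈ Δ.Faces (k + 1)} with _ | ⟨⟨b⟩⟩
    · rw [Subsingleton.elim x 0]
      exact zero_mem _
    have hsum : x = ∑ a, (γ a * x a) • (Pi.single a (γ a) - Pi.single b (γ b)) := by
      simp only [smul_sub, sum_sub_distrib, ← sum_smul]
      rw [show ∑ a, γ a * x a = 0 from hx, zero_smul, sub_zero]
      ext f
      rw [Finset.sum_apply, sum_eq_single f]
      · rcases hγ f with h | h <;> simp [h]
      · intro a _ ha
        simp [ha.symm]
      · simp
    rw [hsum]
    exact sum_mem fun a _ =>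
      Submodule.smul_mem _ _ (single_sub_single_mem_range_tbdry hpm hγ0 a b)

end SComplex

/-- Let `Δ` be an orientable pseudomanifold of dimension `d+1`
without boundary, with facets oriented by `γ` (all coefficients `±1`, `∂γ = 0`).
Then `Σ_k s_k ∂(γ_k)` and `Σ_k t_k ∂(γ_k)` are linearly equivalent if and only if
`Σ_k s_k ≡ Σ_k t_k (mod m)`, where `m` is the number of facets. -/
theorem pseudomanifold_linear_equivalence_mod {n : ℕ} (Δ : SComplex n) (d : ℕ)
    (hpm : Δ.IsPseudomanifold (d + 1))
    (hbd : Δ.pmBoundary (d + 1) = ∅)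
    (γ : Δ.Chain (d + 2))
    (hγ : ∀ f, γ f = 1 ∨ γ f = -1)
    (hγ0 : Δ.bdry (d + 1) γ = 0)
    (s t : {f // f ∈ Δ.Faces (d + 2)} → ℤ) :
    (Δ.bdry (d + 1) (fun f => s f * γ f) - Δ.bdry (d + 1) (fun f => t f * γ f)
        ∈ LinearMap.range (Δ.Lap d)) ↔
      Int.ModEq ((Δ.Faces (d + 2)).card : ℤ) (∑ f, s f) (∑ f, t f) := by
  have hγγ : ∀ f, γ f * γ f = 1 := fun f => by rcases hγ f with h | h <;> simp [h]
  have hdot : ∀ z : ℤ, γ ⬝ᵥ ((fun f => s f * γ f) - (fun f => t f * γ f) - z • γ) =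
      ∑ f, s f - ∑ f, t f - z * ((Δ.Faces (d + 2)).card : ℤ) := by
    intro z
    have hterm : ∀ f, γ f * (s f * γ f - t f * γ f - z * γ f) = s f - t f - z := fun f => by
      linear_combination (s f - t f - z) * hγγ f
    simp only [dotProduct, Pi.sub_apply, Pi.smul_apply, smul_eq_mul, hterm, sum_sub_distrib]
    simp [mul_comm]
  rw [← map_sub, Int.modEq_comm, Int.modEq_iff_dvd]
  constructor
  · rintro ⟨c, hc⟩
    rw [SComplex.Lap_apply, eq_comm, ← sub_eq_zero, ← map_sub] at hc
    obtain ⟨z, hz⟩ := SComplex.exists_eq_smul_of_bdry_eq_zero hpm hγ hγ0 hc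
    refine ⟨z, ?_⟩
    have h := (SComplex.mem_range_tbdry_iff hpm hγ hγ0).mp ⟨c, rfl⟩
    rw [sub_eq_iff_eq_add, ← sub_eq_iff_eq_add'] at hz
    rw [← hz, hdot] at h
    linarith
  · rintro ⟨z, hz⟩
    obtain ⟨c, hc⟩ := (SComplex.mem_range_tbdry_iff hpm hγ hγ0).mpr
      ((hdot z).trans (by rw [hz]; ring))
    refine ⟨c, ?_⟩
    rw [SComplex.Lap_apply, hc, map_sub _ _ (z • γ), map_smul, hγ0, smul_zero, sub_zero]
end

section
/- Every (i−1)-chain of degree zero on Δ is winnable if and only if τ_i(Δ) = 1. That is: every (i−1)-chain σ with σ·h = 0 for all h ∈ ker⁺L_{i−1} is winnable if and only if the i-forest number of Δ equals 1. -/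
open Finset Matrix

theorem Matrix.factorial_mul_det_mul_transpose {R m : Type*} [CommRing R] [Fintype m] {r : ℕ}
    (A : Matrix (Fin r) m R) :
    (r.factorial : R) * (A * Aᵀ).det = ∑ f : Fin r → m, (A.submatrix id f).det ^ 2 := by
  classical
  have expand : (A * Aᵀ).det = ∑ f : Fin r → m, (A.submatrix id f).det * ∏ i, A i (f i) := by
    simp only [det_apply', mul_apply, prod_univ_sum, mul_sum, Fintype.piFinset_univ,
      transpose_apply, submatrix_apply, id, sum_mul, prod_mul_distrib]
    rw [sum_comm]
    simp only [mul_assoc]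
  have reindex (τ : Equiv.Perm (Fin r)) : (A * Aᵀ).det =
      ∑ f : Fin r → m, (A.submatrix id f).det *
        (((Equiv.Perm.sign τ : ℤ) : R) * ∏ i, A i (f (τ i))) := by
    rw [expand, ← (Equiv.arrowCongr τ.symm (Equiv.refl m)).sum_comp]
    refine sum_congr rfl fun f _ => ?_
    change ((A.submatrix id f).submatrix id τ).det * ∏ i, A i (f (τ i)) = _
    rw [det_permute']
    ring
  calc (r.factorial : R) * (A * Aᵀ).det = ∑ τ : Equiv.Perm (Fin r), (A * Aᵀ).det := by
        simp [Fintype.card_perm]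
    _ = _ := by
        rw [sum_congr rfl fun τ _ => reindex τ, sum_comm]
        refine sum_congr rfl fun f _ => ?_
        rw [← mul_sum, sq]
        congr 1
        rw [← det_transpose, det_apply']
        rfl

theorem Finset.card_injective_image_eq {m : Type*} [Fintype m] [DecidableEq m] (s : Finset m) :
    #{f : Fin #s → m | Function.Injective f ∧ univ.image f = s} = (#s).factorial := by
  have key : Fintype.card (Fin #s ↪ s) = (#s).factorial := by
    simp [Fintype.card_embedding_eq, Nat.descFactorial_self]
  rw [← key, ← card_univ]
  symm
  refine card_bij (fun e _ i => (e i : m)) (fun e _ => ?_) (fun e _ e' _ h => ?_) fun f hf => ?_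
  · have hinj : Function.Injective fun i => (e i : m) := Subtype.val_injective.comp e.injective
    refine mem_filter.2 ⟨mem_univ _, hinj, eq_of_subset_of_card_le ?_ ?_⟩
    · intro x hx
      obtain ⟨i, -, rfl⟩ := mem_image.1 hx
      exact (e i).2
    · rw [card_image_of_injective _ hinj, card_univ, Fintype.card_fin]
  · ext i
    exact congrFun h i
  · obtain ⟨-, hinj, him⟩ := mem_filter.1 hf
    have hmem (i) : f i ∈ s := him.le (mem_image_of_mem _ (mem_univ i))
    exact ⟨⟨fun i => ⟨f i, hmem i⟩, fun i j h => hinj (congrArg Subtype.val h)⟩, mem_univ _, rfl⟩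

/-- The **Cauchy–Binet formula** for `A * Aᵀ`. -/
theorem Matrix.det_mul_transpose_eq_sum {m : Type*} [Fintype m] [DecidableEq m] {r : ℕ}
    (A : Matrix (Fin r) m ℤ) (c : Finset m → ℤ)
    (hc : ∀ f : Fin r → m, Function.Injective f →
      (A.submatrix id f).det ^ 2 = c (univ.image f)) :
    (A * Aᵀ).det = ∑ s ∈ powersetCard r univ, c s := by
  have hr : (r.factorial : ℤ) ≠ 0 := mod_cast r.factorial_ne_zero
  refine mul_left_cancel₀ hr ?_
  rw [factorial_mul_det_mul_transpose, mul_sum]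
  have hzero (f : Fin r → m) (hf : ¬ Function.Injective f) : (A.submatrix id f).det = 0 := by
    simp only [Function.Injective, not_forall] at hf
    obtain ⟨i, j, hij, hne⟩ := hf
    exact det_zero_of_column_eq hne fun k => by simp [hij]
  rw [← sum_filter_of_ne (p := Function.Injective) fun f _ hne => by
      by_contra hf
      exact hne (by simp [hzero f hf]),
    ← sum_fiberwise_of_maps_to (t := powersetCard r univ) (g := fun f => univ.image f)
      fun f hf => mem_powersetCard.2 ⟨subset_univ _, by
        simp [card_image_of_injective _ (mem_filter.1 hf).2]⟩]
  refine sum_congr rfl fun s hs => ?_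
  obtain rfl := (mem_powersetCard.1 hs).2
  rw [filter_filter, ← card_injective_image_eq s, ← nsmul_eq_mul]
  refine sum_eq_card_nsmul fun f hf => ?_
  obtain ⟨-, hinj, him⟩ := mem_filter.1 hf
  rw [hc f hinj, him]

theorem Submodule.exists_matrix_of_saturated {m : Type*} [Fintype m] [DecidableEq m]
    (P : Submodule ℤ (m → ℤ)) (hP : ∀ c : ℤ, c ≠ 0 → ∀ x, c • x ∈ P → x ∈ P) :
    ∃ (r : ℕ) (U : Matrix m (Fin r) ℤ) (V : Matrix (Fin r) m ℤ),
      V * U = 1 ∧ ∀ x, x ∈ P ↔ ∃ y, U *ᵥ y = x := by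
  have : Module.IsTorsionFree ℤ ((m → ℤ) ⧸ P) := by
    refine .of_smul_eq_zero fun c x h => ?_
    obtain ⟨x, rfl⟩ := P.mkQ_surjective x
    rw [or_iff_not_imp_left]
    intro hc
    rw [← map_smul, P.mkQ_apply, Submodule.Quotient.mk_eq_zero] at h
    rw [P.mkQ_apply, Submodule.Quotient.mk_eq_zero]
    exact hP c hc x h
  obtain ⟨s, hs⟩ := P.mkQ.exists_rightInverse_of_surjective P.range_mkQ
  have hs (x) : P.mkQ (s x) = x := LinearMap.congr_fun hs x
  let q : (m → ℤ) →ₗ[ℤ] P := (LinearMap.id - s ∘ₗ P.mkQ).codRestrict P fun x => by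
    rw [← Submodule.Quotient.mk_eq_zero, ← P.mkQ_apply]
    simp only [LinearMap.sub_apply, LinearMap.id_apply, LinearMap.comp_apply, map_sub, hs, sub_self]
  have hq (x : P) : q x = x := by
    ext1
    have : P.mkQ (x : m → ℤ) = 0 := by simp
    simp [q, this, -mkQ_apply]
  let b := Module.finBasis ℤ P
  let u : (Fin (Module.finrank ℤ P) → ℤ) →ₗ[ℤ] (m → ℤ) :=
    P.subtype ∘ₗ b.equivFun.symm.toLinearMap
  refine ⟨_, LinearMap.toMatrix' u, LinearMap.toMatrix' (b.equivFun.toLinearMap ∘ₗ q), ?_, ?_⟩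
  · rw [← LinearMap.toMatrix'_comp, ← LinearMap.toMatrix'_id]
    congr 1
    refine LinearMap.ext fun y => ?_
    simp [u, hq, -Module.Basis.equivFun_symm_apply]
  · intro x
    simp only [LinearMap.toMatrix'_mulVec]
    constructor
    · intro hx
      exact ⟨b.equivFun ⟨x, hx⟩, congrArg Subtype.val (b.equivFun.symm_apply_apply ⟨x, hx⟩)⟩
    · rintro ⟨y, rfl⟩
      exact Subtype.property _

theorem Matrix.natCard_quotient_range_mulVecLin {m : Type*} [Fintype m] [DecidableEq m]
    (D : Matrix m m ℤ) (hD : D.det ≠ 0) :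
    Nat.card ((m → ℤ) ⧸ LinearMap.range D.mulVecLin) = D.det.natAbs := by
  have hinj : Function.Injective D.mulVecLin := mulVec_injective_of_det_ne_zero hD
  rw [← Submodule.natAbs_det_equiv _ (LinearEquiv.ofInjective _ hinj), ← LinearMap.det_toLin']
  rfl

theorem Matrix.mul_transpose_mulVec_eq_zero {l m : Type*} [Fintype l] [Fintype m]
    (A : Matrix l m ℤ) (x : l → ℤ) : (A * Aᵀ) *ᵥ x = 0 ↔ Aᵀ *ᵥ x = 0 := by
  simpa [conjTranspose_eq_transpose_of_trivial] using self_mul_conjTranspose_mulVec_eq_zero A x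

/-- The vectors orthogonal to the kernel of a matrix. -/
def Matrix.kerOrthogonal {l m : Type*} [Fintype l] [Fintype m] (L : Matrix m l ℤ) :
    Submodule ℤ (l → ℤ) where
  carrier := {x | ∀ y, L *ᵥ y = 0 → x ⬝ᵥ y = 0}
  add_mem' hx hx' y hy := by rw [add_dotProduct, hx y hy, hx' y hy, add_zero]
  zero_mem' y _ := zero_dotProduct y
  smul_mem' c x hx y hy := by rw [smul_dotProduct, hx y hy, smul_zero]

/-- A symmetric integer matrix maps onto a subgroup of finite index
of the orthogonal complement of its kernel. -/
theorem Matrix.IsSymm.exists_smul_kerOrthogonal {l : Type*} [Fintype l]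
    {L : Matrix l l ℤ} (hL : L.IsSymm) :
    ∃ c : ℤ, c ≠ 0 ∧ ∀ x ∈ L.kerOrthogonal, ∃ y, L *ᵥ y = c • x := by
  let P := L.kerOrthogonal
  have hmem (x) : L *ᵥ x ∈ P := fun y hy => by
    rw [dotProduct_comm, dotProduct_mulVec, ← mulVec_transpose, hL.eq, hy, zero_dotProduct]
  let f : P →ₗ[ℤ] P := L.mulVecLin.restrict fun x _ => hmem x
  have hf : Function.Injective f := by
    rw [← LinearMap.ker_eq_bot, LinearMap.ker_eq_bot']
    rintro ⟨x, hx⟩ h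
    have h0 : L *ᵥ x = 0 := congrArg Subtype.val h
    exact Subtype.ext (dotProduct_self_eq_zero.1 (hx x h0))
  have hfin : Finite (P ⧸ LinearMap.range f) :=
    Submodule.finiteQuotientOfFreeOfRankEq _ (LinearMap.finrank_range_of_inj hf)
  refine ⟨Nat.card (P ⧸ LinearMap.range f), mod_cast Nat.card_pos.ne', fun x hx => ?_⟩
  have h : (Nat.card (P ⧸ LinearMap.range f)) • (LinearMap.range f).mkQ ⟨x, hx⟩ = 0 :=
    card_nsmul_eq_zero'
  rw [← map_nsmul, Submodule.mkQ_apply, Submodule.Quotient.mk_eq_zero] at h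
  obtain ⟨y, hy⟩ := h
  refine ⟨y, ?_⟩
  rw [natCast_zsmul]
  exact congrArg Subtype.val hy

/-- Factorization of an integer matrix through the saturation of its column space. -/
theorem Matrix.exists_saturated_factorization {l m : Type*} [Fintype l] [DecidableEq l]
    [Fintype m] (A : Matrix l m ℤ) :
    ∃ (r : ℕ) (U : Matrix l (Fin r) ℤ) (V : Matrix (Fin r) l ℤ),
      V * U = 1 ∧ U * (V * A) = A ∧
      (∀ x, x ∈ (A * Aᵀ).kerOrthogonal ↔ ∃ y, U *ᵥ y = x) ∧
      ∃ c : ℤ, c ≠ 0 ∧ ∀ y, ∃ z, A *ᵥ z = c • (U *ᵥ y) := by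
  obtain ⟨r, U, V, hVU, hU⟩ :=
    Submodule.exists_matrix_of_saturated (A * Aᵀ).kerOrthogonal fun c hc x hx y hy => by
      have := hx y hy
      rw [smul_dotProduct, smul_eq_mul] at this
      exact (mul_eq_zero.1 this).resolve_left hc
  have hsymm : (A * Aᵀ).IsSymm := by simp [IsSymm]
  refine ⟨r, U, V, hVU, ?_, hU, ?_⟩
  · classical
    refine ext_of_mulVec_single fun i => ?_
    have hmem : A *ᵥ Pi.single i 1 ∈ (A * Aᵀ).kerOrthogonal := fun y hy => by
      rw [mul_transpose_mulVec_eq_zero] at hy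
      rw [dotProduct_comm, dotProduct_mulVec, ← mulVec_transpose, hy, zero_dotProduct]
    obtain ⟨y, hy⟩ := (hU _).1 hmem
    rw [← mulVec_mulVec, ← mulVec_mulVec, ← hy, mulVec_mulVec y V U, hVU, one_mulVec]
  · obtain ⟨c, hc, h⟩ := hsymm.exists_smul_kerOrthogonal
    refine ⟨c, hc, fun y => ?_⟩
    obtain ⟨z, hz⟩ := h _ ((hU _).2 ⟨y, rfl⟩)
    exact ⟨Aᵀ *ᵥ z, by rw [mulVec_mulVec, hz]⟩

theorem Matrix.kerOrthogonal_le_range_iff {l m : Type*} [Fintype l]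
    [Fintype m] {r : ℕ} {A : Matrix l m ℤ} {U : Matrix l (Fin r) ℤ} {V : Matrix (Fin r) l ℤ}
    (hVU : V * U = 1) (hA : U * (V * A) = A)
    (hU : ∀ x, x ∈ (A * Aᵀ).kerOrthogonal ↔ ∃ y, U *ᵥ y = x) :
    (∀ x ∈ (A * Aᵀ).kerOrthogonal, ∃ y, (A * Aᵀ) *ᵥ y = x) ↔
      IsUnit (V * A * (V * A)ᵀ).det := by
  have hUV : Uᵀ * Vᵀ = 1 := by rw [← transpose_mul, hVU, transpose_one]
  have hL : A * Aᵀ = U * (V * A * (V * A)ᵀ) * Uᵀ := by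
    conv_lhs => rw [← hA]
    rw [transpose_mul]
    simp only [Matrix.mul_assoc]
  rw [← isUnit_iff_isUnit_det, ← mulVec_surjective_iff_isUnit]
  constructor
  · intro h y
    obtain ⟨z, hz⟩ := h _ ((hU _).2 ⟨y, rfl⟩)
    refine ⟨Uᵀ *ᵥ z, ?_⟩
    have := congrArg (V *ᵥ ·) hz
    simp only [mulVec_mulVec, hVU, one_mulVec] at this
    rw [← this, mulVec_mulVec, hL, ← Matrix.mul_assoc, ← Matrix.mul_assoc V, hVU, Matrix.one_mul]
  · intro h x hx
    obtain ⟨y, rfl⟩ := (hU x).1 hx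
    obtain ⟨z, rfl⟩ := h y
    refine ⟨Vᵀ *ᵥ z, ?_⟩
    rw [hL, mulVec_mulVec, Matrix.mul_assoc _ Uᵀ, hUV, Matrix.mul_one, mulVec_mulVec]

theorem Matrix.finrank_range_of_saturated_factorization {l m : Type*} [Fintype l]
    [Fintype m] {r : ℕ} {A : Matrix l m ℤ} {U : Matrix l (Fin r) ℤ} {V : Matrix (Fin r) l ℤ}
    (hVU : V * U = 1) (hA : U * (V * A) = A) {c : ℤ} (hc : c ≠ 0)
    (hcA : ∀ y, ∃ z, A *ᵥ z = c • (U *ᵥ y)) :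
    Module.finrank ℤ (LinearMap.range A.mulVecLin) = r := by
  have hinj : Function.Injective U.mulVecLin :=
    Function.LeftInverse.injective (g := V.mulVecLin) fun y => by
      simp [hVU]
  have hle : LinearMap.range A.mulVecLin ≤ LinearMap.range U.mulVecLin := by
    rintro _ ⟨y, rfl⟩
    exact ⟨(V * A) *ᵥ y, by simp [hA]⟩
  have hrU : Module.finrank ℤ (LinearMap.range U.mulVecLin) = r := by
    rw [LinearMap.finrank_range_of_inj hinj, Module.finrank_fin_fun]
  refine le_antisymm ((Submodule.finrank_mono hle).trans hrU.le) ?_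
  let g : (Fin r → ℤ) →ₗ[ℤ] LinearMap.range A.mulVecLin :=
    (c • U.mulVecLin).codRestrict _ fun y => hcA y
  have hg : Function.Injective g := fun x y hxy => by
    have h : c • (U *ᵥ x) = c • (U *ᵥ y) := congrArg Subtype.val hxy
    exact hinj (smul_right_injective _ hc h)
  simpa using LinearMap.finrank_le_finrank_of_injective hg

theorem Matrix.mulVec_eq_submatrix_mulVec {l m k : Type*} [Fintype m] [Fintype k]
    (A : Matrix l m ℤ) {e : k → m} (he : Function.Injective e) {x : m → ℤ}
    (hx : ∀ i, i ∉ Set.range e → x i = 0) :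
    A *ᵥ x = A.submatrix id e *ᵥ (x ∘ e) := by
  ext i
  exact (Fintype.sum_of_injective e he _ _ (fun j hj => by rw [hx j hj, mul_zero])
    fun _ => rfl).symm

namespace SComplex

theorem sum_neg_one_pow_mul_sub_pos {n : ℕ} (c : ℤ) (f : Finset (Fin n)) (hf : f.Nonempty)
    (hc : ∀ v ∈ f, (v : ℤ) < c) :
    0 < ∑ v ∈ f, (-1 : ℤ) ^ #{x ∈ f | x < v} * (c - v) := by
  suffices h : ∀ M : ℤ, (∀ v ∈ f, (v : ℤ) < M) → M ≤ c → f.Nonempty →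
      (if Even #f then 0 else c - M) < ∑ v ∈ f, (-1 : ℤ) ^ #{x ∈ f | x < v} * (c - v) by
    have := h c hc le_rfl hf
    split_ifs at this <;> simpa using this
  clear hc hf
  induction f using Finset.induction_on_max with
  | empty => simp
  | insert a s ha ih =>
    intro M hM hMc _
    have hnot : a ∉ s := fun h => lt_irrefl a (ha a h)
    have hlast : {x ∈ insert a s | x < a} = s := by
      ext x
      simp only [mem_filter, mem_insert]
      exact ⟨fun ⟨h, hx⟩ => h.resolve_left hx.ne, fun h => ⟨Or.inr h, ha x h⟩⟩
    have hrest : ∑ v ∈ s, (-1 : ℤ) ^ #{x ∈ insert a s | x < v} * (c - v) =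
        ∑ v ∈ s, (-1 : ℤ) ^ #{x ∈ s | x < v} * (c - v) := by
      refine sum_congr rfl fun v hv => ?_
      rw [filter_insert, if_neg (ha v hv).not_gt]
    rw [sum_insert hnot, hlast, hrest, card_insert_of_notMem hnot]
    have haM : (a : ℤ) < M := hM a (mem_insert_self a s)
    have hsa : ∀ v ∈ s, (v : ℤ) < a := fun v hv => by exact_mod_cast ha v hv
    rcases s.eq_empty_or_nonempty with rfl | hs
    · simp
      omega
    have := ih a hsa (by omega) hs
    by_cases hev : Even #s
    · simp only [hev, if_true, Nat.even_add_one, not_true, if_false, hev.neg_one_pow] at this ⊢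
      omega
    · simp only [hev, if_false, Nat.even_add_one, not_false_iff, if_true,
        (Nat.not_even_iff_odd.1 hev).neg_one_pow] at this ⊢
      omega

variable {n : ℕ}

theorem bcoef_erase {f : Finset (Fin n)} {v : Fin n} (hv : v ∈ f) :
    bcoef f (f.erase v) = (-1) ^ #{x ∈ f | x < v} := by
  rw [bcoef, if_pos ⟨erase_subset _ _, (card_erase_add_one hv).symm⟩, sdiff_erase_self hv,
    sum_singleton]

theorem exists_eq_erase_of_bcoef_ne_zero {f g : Finset (Fin n)} (h : bcoef f g ≠ 0) :
    ∃ v ∈ f, g = f.erase v := by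
  rw [bcoef] at h
  split_ifs at h with hfg
  · obtain ⟨v, hv⟩ := card_eq_one.1 (show #(f \ g) = 1 by
      rw [card_sdiff_of_subset hfg.1, hfg.2]; omega)
    have hvf : v ∈ f ∧ v ∉ g := by
      rw [← mem_sdiff, hv]
      exact mem_singleton_self v
    refine ⟨v, hvf.1, ?_⟩
    rw [← sdiff_singleton_eq_erase, ← hv, Finset.sdiff_sdiff_eq_self hfg.1]
  · exact absurd rfl h

variable (Δ : SComplex n)

theorem erase_mem_faces {k : ℕ} {f : Finset (Fin n)} (hf : f ∈ Δ.Faces (k + 1)) {v : Fin n}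
    (hv : v ∈ f) : f.erase v ∈ Δ.Faces k := by
  obtain ⟨hf, hcard⟩ := mem_filter.1 hf
  refine mem_filter.2 ⟨Δ.down_closed f hf _ (erase_subset v f), ?_⟩
  rw [card_erase_of_mem hv, hcard, Nat.add_sub_cancel]

theorem sum_bcoef_mul {k : ℕ} (f : {f // f ∈ Δ.Faces (k + 1)}) (x : Finset (Fin n) → ℤ) :
    ∑ g : {g // g ∈ Δ.Faces k}, bcoef f.1 g.1 * x g.1 =
      ∑ v ∈ (f : Finset (Fin n)),
        (-1) ^ #{y ∈ (f : Finset (Fin n)) | y < v} * x (f.1.erase v) := by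
  rw [Finset.sum_coe_sort (Δ.Faces k) fun g => bcoef f.1 g * x g]
  symm
  refine sum_bij_ne_zero (fun v _ _ => f.1.erase v) (fun v hv _ => Δ.erase_mem_faces f.2 hv)
    (fun v hv _ w hw _ h => ?_) (fun g _ hg => ?_) fun v hv _ => by rw [bcoef_erase hv]
  · by_contra hne
    have : v ∈ f.1.erase w := mem_erase.2 ⟨hne, hv⟩
    rw [← h] at this
    exact notMem_erase v _ this
  · obtain ⟨v, hv, rfl⟩ := exists_eq_erase_of_bcoef_ne_zero (left_ne_zero_of_mul hg)
    exact ⟨v, hv, by rwa [← bcoef_erase hv], rfl⟩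

theorem sum_sign_mul_bcoef_erase (f h : Finset (Fin n)) :
    ∑ v ∈ f, (-1) ^ #{y ∈ f | y < v} * bcoef (f.erase v) h = 0 := by
  by_cases hfh : h ⊆ f ∧ #f = #h + 2
  swap
  · refine sum_eq_zero fun v hv => ?_
    rw [bcoef, if_neg, mul_zero]
    rintro ⟨hsub, hcard⟩
    refine hfh ⟨hsub.trans (erase_subset v f), ?_⟩
    rw [← card_erase_add_one hv, hcard]
  have key : ∀ a b, a < b → f \ h = {a, b} →
      ∑ v ∈ f, (-1) ^ #{y ∈ f | y < v} * bcoef (f.erase v) h = 0 := by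
    intro a b hab hsd
    have ha : a ∈ f ∧ a ∉ h := by rw [← mem_sdiff, hsd]; simp
    have hb : b ∈ f ∧ b ∉ h := by rw [← mem_sdiff, hsd]; simp
    have hbe : b ∈ f.erase a := mem_erase.2 ⟨hab.ne', hb.1⟩
    have hae : a ∈ f.erase b := mem_erase.2 ⟨hab.ne, ha.1⟩
    have h1 : (f.erase a).erase b = h := by
      rw [← Finset.sdiff_sdiff_eq_self hfh.1, hsd]
      ext x
      simp only [mem_erase, mem_sdiff, mem_insert, mem_singleton]
      tauto
    have h2 : (f.erase b).erase a = h := by rw [erase_right_comm, h1]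
    have hc1 : bcoef (f.erase a) h = (-1) ^ #{x ∈ f.erase a | x < b} := by
      rw [← bcoef_erase hbe, h1]
    have hc2 : bcoef (f.erase b) h = (-1) ^ #{x ∈ f.erase b | x < a} := by
      rw [← bcoef_erase hae, h2]
    have hn1 : #{x ∈ f | x < b} = #{x ∈ f.erase a | x < b} + 1 := by
      rw [← card_erase_add_one (mem_filter.2 ⟨ha.1, hab⟩), filter_erase]
    have hn2 : {x ∈ f.erase b | x < a} = {x ∈ f | x < a} := by
      ext x
      simp only [mem_filter, mem_erase]
      exact ⟨fun hx => ⟨hx.1.2, hx.2⟩, fun hx => ⟨⟨(hx.2.trans hab).ne, hx.1⟩, hx.2⟩⟩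
    rw [← sum_subset (s₁ := {a, b}) (by simp [insert_subset_iff, ha.1, hb.1]) fun v hv hvab => ?_,
      sum_pair hab.ne, hc1, hc2, hn1, hn2]
    · ring
    · rw [bcoef, if_neg, mul_zero]
      rintro ⟨hsub, -⟩
      rw [← hsd, mem_sdiff, not_and_not_right] at hvab
      exact notMem_erase v f (hsub (hvab hv))
  obtain ⟨a, b, hab, hsd⟩ := card_eq_two.1 (show #(f \ h) = 2 by
    rw [card_sdiff_of_subset hfh.1, hfh.2]; omega)
  rcases lt_or_gt_of_ne hab with hlt | hlt
  · exact key a b hlt hsd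
  · exact key b a hlt (by rw [hsd, pair_comm])

theorem B_mul_B (k : ℕ) : Δ.B k * Δ.B (k + 1) = 0 := by
  ext h f
  simp only [mul_apply, B, Matrix.zero_apply]
  simp only [mul_comm (bcoef _ h.1)]
  rw [Δ.sum_bcoef_mul f fun g => bcoef g h]
  exact sum_sign_mul_bcoef_erase f.1 h.1

/-- Some coboundary is positive on every face. -/
theorem exists_pos_coboundary (k : ℕ) : ∃ x : Δ.Chain k, ∀ f, 0 < ((Δ.B k)ᵀ *ᵥ x) f := by
  refine ⟨fun g => 1 + ∑ v ∈ g.1, (v : ℤ), fun f => ?_⟩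
  change 0 < ∑ g : {g // g ∈ Δ.Faces k}, bcoef f.1 g.1 * (1 + ∑ v ∈ g.1, (v : ℤ))
  rw [Δ.sum_bcoef_mul f fun g => 1 + ∑ v ∈ g, (v : ℤ)]
  have hf : f.1.Nonempty := by
    rw [← card_pos, (mem_filter.1 f.2).2]
    exact k.succ_pos
  convert sum_neg_one_pow_mul_sub_pos (1 + ∑ v ∈ f.1, (v : ℤ)) f.1 hf fun v hv => ?_
    using 3 with v hv
  · rw [← add_sum_erase f.1 (fun v => (v : ℤ)) hv]
    ring
  · have := single_le_sum (f := fun v : Fin n => (v : ℤ)) (fun _ _ => by positivity) hv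
    omega

theorem exists_pos_mem_ker (i : ℕ) : ∃ p : Δ.Chain (i + 1), (∀ f, 0 < p f) ∧ Δ.Lap i p = 0 := by
  obtain ⟨x, hx⟩ := Δ.exists_pos_coboundary i
  refine ⟨_, hx, ?_⟩
  rw [Lap, mulVecLin_apply, LapM, ← mulVec_mulVec, mulVec_mulVec x, ← transpose_mul, B_mul_B,
    transpose_zero, zero_mulVec, mulVec_zero]

theorem degree_zero_iff_mem_kerOrthogonal (i : ℕ) (σ : Δ.Chain (i + 1)) :
    (∀ h ∈ Δ.kerPlus i, Δ.dot σ h = 0) ↔ σ ∈ (Δ.LapM i).kerOrthogonal := by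
  refine ⟨fun hσ τ hτ => ?_, fun hσ h hh => hσ h hh.1⟩
  obtain ⟨p, hp, hLp⟩ := Δ.exists_pos_mem_ker i
  have hτ : Δ.Lap i τ = 0 := hτ
  obtain ⟨N, hN⟩ : ∃ N : ℤ, ∀ f, 0 ≤ N + τ f := by
    refine ⟨∑ f, |τ f|, fun f => ?_⟩
    have h1 := single_le_sum (f := fun f => |τ f|) (fun _ _ => abs_nonneg _) (mem_univ f)
    have h2 := neg_abs_le (τ f)
    omega
  have hp0 : σ ⬝ᵥ p = 0 := hσ p ⟨hLp, fun f => (hp f).le⟩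
  have hsum : σ ⬝ᵥ (|N| • p + τ) = 0 := by
    refine hσ _ ⟨by rw [map_add, map_smul, hLp, hτ, smul_zero, add_zero], fun f => ?_⟩
    have h1 := hN f
    have h2 : |N| * 1 ≤ |N| * p f := mul_le_mul_of_nonneg_left (hp f) (abs_nonneg N)
    have h3 := le_abs_self N
    simp only [Pi.add_apply, Pi.smul_apply, smul_eq_mul]
    omega
  rwa [dotProduct_add, dotProduct_smul, hp0, smul_zero, zero_add] at hsum

theorem winnable_iff_of_mem_kerOrthogonal {i : ℕ} {σ : Δ.Chain (i + 1)}
    (hσ : σ ∈ (Δ.LapM i).kerOrthogonal) :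
    Δ.Winnable i σ ↔ ∃ τ, Δ.LapM i *ᵥ τ = σ := by
  constructor
  · rintro ⟨σ', heff, τ, hτ⟩
    obtain ⟨p, hp, hLp⟩ := Δ.exists_pos_mem_ker i
    have hτ : Δ.LapM i *ᵥ τ = σ' - σ := hτ
    have hLp : Δ.LapM i *ᵥ p = 0 := hLp
    have hsymm : (Δ.LapM i)ᵀ = Δ.LapM i := by simp [LapM]
    have hzero : σ' ⬝ᵥ p = 0 := by
      have : (σ' - σ) ⬝ᵥ p = 0 := by
        rw [← hτ, dotProduct_comm, dotProduct_mulVec, ← mulVec_transpose, hsymm, hLp,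
          zero_dotProduct]
      rwa [sub_dotProduct, hσ p hLp, sub_zero] at this
    have hσ' : σ' = 0 := by
      ext f
      have := (sum_eq_zero_iff_of_nonneg fun f _ => mul_nonneg (heff f) (hp f).le).1 hzero f
        (mem_univ f)
      exact (mul_eq_zero.1 this).resolve_right (hp f).ne'
    exact ⟨-τ, by rw [mulVec_neg, hτ, hσ']; simp⟩
  · rintro ⟨τ, hτ⟩
    refine ⟨0, fun _ => le_rfl, -τ, ?_⟩
    rw [map_neg, zero_sub, ← hτ]
    rfl

theorem range_bdry_le_cycles (j : ℕ) : LinearMap.range (Δ.bdry (j + 1)) ≤ Δ.cycles (j + 1) := by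
  rintro _ ⟨x, rfl⟩
  change Δ.B j *ᵥ (Δ.B (j + 1) *ᵥ x) = 0
  rw [mulVec_mulVec, B_mul_B, zero_mulVec]

theorem finrank_quotient_cycles {k : ℕ} {N : Submodule ℤ (Δ.Chain k)} (hN : N ≤ Δ.cycles k) :
    Module.finrank ℤ (Δ.cycles k ⧸ N.comap (Δ.cycles k).subtype) + Module.finrank ℤ N =
      Module.finrank ℤ (Δ.cycles k) := by
  rw [← (N.comap (Δ.cycles k).subtype).finrank_quotient_add_finrank,
    (Submodule.comapSubtypeEquivOfLe hN).finrank_eq]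

theorem finrank_range_bdry_add_finrank_cycles (k : ℕ) :
    Module.finrank ℤ (LinearMap.range (Δ.bdry k)) + Module.finrank ℤ (Δ.cycles (k + 1)) =
      #(Δ.Faces (k + 1)) := by
  have h := (LinearMap.ker (Δ.bdry k)).finrank_quotient_add_finrank
  rw [(Δ.bdry k).quotKerEquivRange.finrank_eq] at h
  exact h.trans (by simp)

section Forest

variable {j r : ℕ} {U : Matrix {f // f ∈ Δ.Faces (j + 1)} (Fin r) ℤ}
  {V : Matrix (Fin r) {f // f ∈ Δ.Faces (j + 1)} ℤ}
  {e : Fin r → {f // f ∈ Δ.Faces (j + 1 + 1)}}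

theorem mem_suppIn_image_iff {k : ℕ} {e : Fin r → {f // f ∈ Δ.Faces k}} (σ : Δ.Chain k) :
    σ ∈ Δ.suppIn k ((univ.image e).map (.subtype _)) ↔ ∀ f, f ∉ Set.range e → σ f = 0 := by
  refine forall_congr' fun f => ?_
  simp

theorem bdry_of_mem_suppIn (hA : U * (V * Δ.B (j + 1)) = Δ.B (j + 1))
    (he : Function.Injective e) {σ : Δ.Chain (j + 1 + 1)}
    (hσ : σ ∈ Δ.suppIn (j + 1 + 1) ((univ.image e).map (.subtype _))) :
    Δ.bdry (j + 1) σ = U *ᵥ ((V * Δ.B (j + 1)).submatrix id e *ᵥ (σ ∘ e)) := by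
  rw [mem_suppIn_image_iff] at hσ
  rw [← mulVec_eq_submatrix_mulVec _ he hσ, mulVec_mulVec, hA]
  rfl

theorem extend_mem_suppIn (he : Function.Injective e) (y : Fin r → ℤ) :
    Function.extend e y 0 ∈ Δ.suppIn (j + 1 + 1) ((univ.image e).map (.subtype _)) ∧
      Function.extend e y 0 ∘ e = y := by
  refine ⟨(Δ.mem_suppIn_image_iff _).2 fun f hf => ?_, funext fun i => he.extend_apply _ _ _⟩
  exact Function.extend_apply' _ _ _ hf

theorem map_bdry_suppIn (hA : U * (V * Δ.B (j + 1)) = Δ.B (j + 1)) (he : Function.Injective e) :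
    (Δ.suppIn (j + 1 + 1) ((univ.image e).map (.subtype _))).map (Δ.bdry (j + 1)) =
      LinearMap.range (U.mulVecLin ∘ₗ ((V * Δ.B (j + 1)).submatrix id e).mulVecLin) := by
  ext x
  constructor
  · rintro ⟨σ, hσ, rfl⟩
    exact ⟨σ ∘ e, (Δ.bdry_of_mem_suppIn hA he hσ).symm⟩
  · rintro ⟨y, rfl⟩
    obtain ⟨hmem, hy⟩ := Δ.extend_mem_suppIn he y
    refine ⟨_, hmem, ?_⟩
    rw [Δ.bdry_of_mem_suppIn hA he hmem, hy]
    rfl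

theorem isSpanningForest_iff_det_ne_zero (hVU : V * U = 1)
    (hA : U * (V * Δ.B (j + 1)) = Δ.B (j + 1))
    (hr : Module.finrank ℤ (LinearMap.range (Δ.bdry (j + 1))) = r)
    (he : Function.Injective e) :
    Δ.IsSpanningForest (j + 1) ((univ.image e).map (.subtype _)) ↔
      ((V * Δ.B (j + 1)).submatrix id e).det ≠ 0 := by
  have hUinj : Function.Injective U.mulVecLin :=
    Function.LeftInverse.injective (g := V.mulVecLin) fun y => by simp [hVU]
  constructor
  · rintro ⟨-, hinj, -⟩ hdet
    obtain ⟨y, hy0, hy⟩ := exists_mulVec_eq_zero_iff.2 hdet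
    obtain ⟨hmem, hye⟩ := Δ.extend_mem_suppIn he y
    refine hy0 ?_
    rw [← hye, hinj _ hmem (by rw [Δ.bdry_of_mem_suppIn hA he hmem, hye, hy, mulVec_zero])]
    rfl
  · intro hdet
    have hDinj : Function.Injective ((V * Δ.B (j + 1)).submatrix id e).mulVecLin :=
      mulVec_injective_of_det_ne_zero hdet
    refine ⟨?_, fun σ hσ h0 => ?_, ?_, ?_⟩
    · intro f hf
      obtain ⟨f, -, rfl⟩ := mem_map.1 hf
      exact f.2
    · rw [Δ.bdry_of_mem_suppIn hA he hσ] at h0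
      have h1 : σ ∘ e = 0 := (hUinj.comp hDinj) (h0.trans (by simp))
      ext f
      by_cases hf : f ∈ Set.range e
      · obtain ⟨i, rfl⟩ := hf
        exact congrFun h1 i
      · exact (Δ.mem_suppIn_image_iff σ).1 hσ f hf
    · have hN : (Δ.suppIn (j + 1 + 1) ((univ.image e).map (.subtype _))).map (Δ.bdry (j + 1)) ≤
          Δ.cycles (j + 1) := (LinearMap.map_le_range).trans (Δ.range_bdry_le_cycles j)
      have h1 := Δ.finrank_quotient_cycles hN
      have h2 := Δ.finrank_quotient_cycles (Δ.range_bdry_le_cycles j)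
      have h3 : Module.finrank ℤ ((Δ.suppIn (j + 1 + 1)
          ((univ.image e).map (.subtype _))).map (Δ.bdry (j + 1))) = r := by
        rw [Δ.map_bdry_suppIn hA he, LinearMap.finrank_range_of_inj
          (by rw [LinearMap.coe_comp]; exact hUinj.comp hDinj),
          Module.finrank_fin_fun]
      exact Nat.add_right_cancel (h1.trans (h2.symm.trans (by rw [hr, h3]; rfl)))
    · have := Δ.finrank_range_bdry_add_finrank_cycles (j + 1)
      rw [card_map, card_image_of_injective _ he, card_univ, Fintype.card_fin]
      omega

theorem natCard_torsion_forestHom (hVU : V * U = 1)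
    (hA : U * (V * Δ.B (j + 1)) = Δ.B (j + 1)) {c : ℤ} (hc : c ≠ 0)
    (hcA : ∀ y, ∃ z, Δ.B (j + 1) *ᵥ z = c • (U *ᵥ y)) (he : Function.Injective e)
    (hdet : ((V * Δ.B (j + 1)).submatrix id e).det ≠ 0) :
    Nat.card (Submodule.torsion ℤ (Δ.forestHom (j + 1) ((univ.image e).map (.subtype _)))) =
      ((V * Δ.B (j + 1)).submatrix id e).det.natAbs := by
  set D := (V * Δ.B (j + 1)).submatrix id e with hD
  have hUinj : Function.Injective U.mulVecLin :=
    Function.LeftInverse.injective (g := V.mulVecLin) fun y => by simp [hVU]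
  have hUc (y) : U.mulVecLin y ∈ Δ.cycles (j + 1) := by
    obtain ⟨z, hz⟩ := hcA y
    have h := Δ.range_bdry_le_cycles j ⟨z, rfl⟩
    change Δ.B j *ᵥ (Δ.B (j + 1) *ᵥ z) = 0 at h
    rw [hz, mulVec_smul] at h
    exact (smul_eq_zero.1 h).resolve_left hc
  let N := (Δ.suppIn (j + 1 + 1) ((univ.image e).map (.subtype _))).map (Δ.bdry (j + 1))
  have hN : N = LinearMap.range (U.mulVecLin ∘ₗ D.mulVecLin) := Δ.map_bdry_suppIn hA he
  let φ : (Fin r → ℤ) →ₗ[ℤ] Δ.forestHom (j + 1) ((univ.image e).map (.subtype _)) :=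
    (N.comap (Δ.cycles (j + 1)).subtype).mkQ ∘ₗ U.mulVecLin.codRestrict _ hUc
  have hφ (y) : φ y = 0 ↔ y ∈ LinearMap.range D.mulVecLin := by
    have : φ y = 0 ↔ U.mulVecLin y ∈ N := Submodule.Quotient.mk_eq_zero _
    rw [this, hN]
    constructor
    · rintro ⟨z, hz⟩
      exact ⟨z, hUinj hz⟩
    · rintro ⟨z, rfl⟩
      exact ⟨z, rfl⟩
  have hker : LinearMap.ker φ = LinearMap.range D.mulVecLin := by
    ext y
    rw [LinearMap.mem_ker, hφ]
  have hrange : LinearMap.range φ =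
      Submodule.torsion ℤ (Δ.forestHom (j + 1) ((univ.image e).map (.subtype _))) := by
    ext x
    rw [Submodule.mem_torsion_iff]
    constructor
    · rintro ⟨y, rfl⟩
      refine ⟨⟨D.det, mem_nonZeroDivisors_of_ne_zero hdet⟩, ?_⟩
      change D.det • φ y = 0
      rw [← map_smul, hφ]
      exact ⟨D.adjugate *ᵥ y, by
        rw [mulVecLin_apply, mulVec_mulVec, mul_adjugate, smul_mulVec, one_mulVec]⟩
    · rintro ⟨⟨a, ha⟩, hax⟩
      have ha : a ≠ 0 := nonZeroDivisors.ne_zero ha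
      obtain ⟨x, rfl⟩ := Submodule.mkQ_surjective _ x
      have hx : a • x.1 ∈ N := (Submodule.Quotient.mk_eq_zero
        (N.comap (Δ.cycles (j + 1)).subtype) (x := a • x)).1 hax
      rw [hN] at hx
      obtain ⟨z, hz⟩ := hx
      have hz : U *ᵥ (D *ᵥ z) = a • x.1 := hz
      refine ⟨V *ᵥ x.1, congrArg (Submodule.mkQ _) (Subtype.ext ?_)⟩
      change U *ᵥ (V *ᵥ x.1) = x.1
      refine smul_right_injective _ ha ?_
      simp only
      rw [← mulVec_smul, ← mulVec_smul, ← hz, mulVec_mulVec _ V U, hVU, one_mulVec]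
  rw [← hrange, ← Nat.card_congr φ.quotKerEquivRange.toEquiv, hker,
    natCard_quotient_range_mulVecLin D hdet]

end Forest

theorem forestNumber_eq_det {j r : ℕ} {U : Matrix {f // f ∈ Δ.Faces (j + 1)} (Fin r) ℤ}
    {V : Matrix (Fin r) {f // f ∈ Δ.Faces (j + 1)} ℤ} (hVU : V * U = 1)
    (hA : U * (V * Δ.B (j + 1)) = Δ.B (j + 1)) {c : ℤ} (hc : c ≠ 0)
    (hcA : ∀ y, ∃ z, Δ.B (j + 1) *ᵥ z = c • (U *ᵥ y)) :
    (Δ.forestNumber (j + 1) : ℤ) = (V * Δ.B (j + 1) * (V * Δ.B (j + 1))ᵀ).det := by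
  classical
  have hr : Module.finrank ℤ (LinearMap.range (Δ.bdry (j + 1))) = r :=
    finrank_range_of_saturated_factorization hVU hA hc hcA
  let t (F : Finset (Finset (Fin n))) : ℤ :=
    (Nat.card (Submodule.torsion ℤ (Δ.forestHom (j + 1) F)) : ℤ) ^ 2
  rw [det_mul_transpose_eq_sum _ fun s =>
    if Δ.IsSpanningForest (j + 1) (s.map (.subtype _)) then t (s.map (.subtype _)) else 0]
  · rw [forestNumber, ← sum_filter]
    push_cast
    symm
    refine sum_bij (fun s _ => s.map (.subtype _)) (fun s hs => ?_)
      (fun s _ s' _ h => map_injective _ h) (fun F hF => ?_) fun s _ => rfl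
    · have hs := (mem_filter.1 hs).2
      exact mem_filter.2 ⟨mem_powerset.2 hs.1, hs⟩
    · have hF := (mem_filter.1 hF).2
      have hFs : (F.subtype (· ∈ Δ.Faces (j + 1 + 1))).map (.subtype _) = F :=
        subtype_map_of_mem fun f hf => hF.1 hf
      refine ⟨F.subtype (· ∈ Δ.Faces (j + 1 + 1)), mem_filter.2 ⟨?_, by rwa [hFs]⟩, hFs⟩
      refine mem_powersetCard.2 ⟨subset_univ _, ?_⟩
      have := Δ.finrank_range_bdry_add_finrank_cycles (j + 1)
      rw [← card_map (.subtype _), hFs, hF.2.2.2]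
      omega
  · intro e he
    by_cases hdet : ((V * Δ.B (j + 1)).submatrix id e).det = 0
    · rw [if_neg ((Δ.isSpanningForest_iff_det_ne_zero hVU hA hr he).not.2 (not_not.2 hdet)), hdet]
      rfl
    · rw [if_pos ((Δ.isSpanningForest_iff_det_ne_zero hVU hA hr he).2 hdet)]
      simp only [t]
      rw [Δ.natCard_torsion_forestHom hVU hA hc hcA he hdet, Int.natAbs_sq]

end SComplex

/-- (Stated with `i` in place of the paper's `i - 1`, so the paper's
`i` is `i + 1` here.)  Every `i`-chain of degree zero on `Δ` is winnable if and only
if the `(i+1)`-forest number of `Δ` equals `1`. -/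
theorem degree_zero_winnable_iff_forest_number_one {n : ℕ} (Δ : SComplex n) (i : ℕ) :
    (∀ σ : Δ.Chain (i + 1), (∀ h ∈ Δ.kerPlus i, Δ.dot σ h = 0) → Δ.Winnable i σ) ↔
      Δ.forestNumber (i + 1) = 1 := by
  obtain ⟨r, U, V, hVU, hA, hU, c, hc, hcA⟩ := (Δ.B (i + 1)).exists_saturated_factorization
  rw [← Nat.cast_inj (R := ℤ), Nat.cast_one, Δ.forestNumber_eq_det hVU hA hc hcA]
  have hpos : 0 ≤ (V * Δ.B (i + 1) * (V * Δ.B (i + 1))ᵀ).det := by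
    rw [← Δ.forestNumber_eq_det hVU hA hc hcA]
    positivity
  calc (∀ σ : Δ.Chain (i + 1), (∀ h ∈ Δ.kerPlus i, Δ.dot σ h = 0) → Δ.Winnable i σ)
      ↔ ∀ σ ∈ (Δ.LapM i).kerOrthogonal, ∃ τ, Δ.LapM i *ᵥ τ = σ := by
        refine forall_congr' fun σ => ?_
        rw [Δ.degree_zero_iff_mem_kerOrthogonal]
        exact forall_congr' fun hσ => Δ.winnable_iff_of_mem_kerOrthogonal hσ
    _ ↔ IsUnit (V * Δ.B (i + 1) * (V * Δ.B (i + 1))ᵀ).det :=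
        kerOrthogonal_le_range_iff hVU hA hU
    _ ↔ _ := by
        rw [Int.isUnit_iff]
        omega
end
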